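/- arXiv:2205.10836 — 3 statements merged into one kernel-verified Lean document; each statement's English description precedes it below -/
import Mathlib

section
/- Every fair-chores instance with n agents and items on a line admits a connected MMS allocation, i.e., a partition of the items into n connected bundles A_1, ..., A_n with v_i(A_i) >= MMS_i for every agent i. -/
open Finset

noncomputable section

/-- The value of a bundle `S` of items under additive (item-level) valuation `v`. -/
def bundleVal {m : ℕ} (v : Fin m → ℝ) (S : Finset (Fin m)) : ℝ := ∑ e ∈ S, v e

/-- A bundle is connected if it is an interval of the line `e_1, …, e_m`. -/
def IsConnBundle {m : ℕ} (S : Finset (Fin m)) : Prop :=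
  ∀ a ∈ S, ∀ c ∈ S, ∀ b : Fin m, a ≤ b → b ≤ c → b ∈ S

/-- A connected allocation: pairwise disjoint connected bundles covering all items. -/
def ConnAlloc (n m : ℕ) (A : Fin n → Finset (Fin m)) : Prop :=
  (∀ i, IsConnBundle (A i)) ∧
  (∀ i j : Fin n, i ≠ j → Disjoint (A i) (A j)) ∧
  (∀ e : Fin m, ∃ i, e ∈ A i)

/-- The maximin share of an agent with valuation `v`: the maximum over connected
`n`-partitions of the minimum bundle value. -/
def mmsVal (n m : ℕ) (v : Fin m → ℝ) : ℝ :=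
  sSup { x : ℝ | ∃ A : Fin n → Finset (Fin m), ConnAlloc n m A ∧ x = ⨅ j, bundleVal v (A j) }

/-- Utilitarian welfare of an allocation. -/
def utilW (n m : ℕ) (v : Fin n → Fin m → ℝ) (A : Fin n → Finset (Fin m)) : ℝ :=
  ∑ i, bundleVal (v i) (A i)

/-- Egalitarian welfare of an allocation. -/
def egalW (n m : ℕ) (v : Fin n → Fin m → ℝ) (A : Fin n → Finset (Fin m)) : ℝ :=
  ⨅ i, bundleVal (v i) (A i)

/-- Optimal utilitarian welfare over all connected allocations. -/
def optU (n m : ℕ) (v : Fin n → Fin m → ℝ) : ℝ :=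
  sSup { x : ℝ | ∃ A, ConnAlloc n m A ∧ x = utilW n m v A }

/-- Optimal egalitarian welfare over all connected allocations. -/
def optE (n m : ℕ) (v : Fin n → Fin m → ℝ) : ℝ :=
  sSup { x : ℝ | ∃ A, ConnAlloc n m A ∧ x = egalW n m v A }

/-- Items with index in `[a, c)`. -/
def ivl (m a c : ℕ) : Finset (Fin m) := Finset.univ.filter (fun e => a ≤ e.val ∧ e.val < c)

/-- The suffix from `s` can be cut into `k` intervals of value at least `t`. -/
def GoodSplit {m : ℕ} (v : Fin m → ℝ) (t : ℝ) : ℕ → ℕ → Prop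
  | 0, s => m ≤ s
  | k + 1, s => ∃ c, s ≤ c ∧ t ≤ bundleVal v (ivl m s c) ∧ GoodSplit v t k c

lemma mem_ivl {m a c : ℕ} (e : Fin m) : e ∈ ivl m a c ↔ a ≤ e.val ∧ e.val < c := by
  simp [ivl]

lemma bundleVal_anti {m : ℕ} {v : Fin m → ℝ} (hv : ∀ e, v e ≤ 0) {S T : Finset (Fin m)}
    (h : S ⊆ T) : bundleVal v T ≤ bundleVal v S := by
  unfold bundleVal
  have := Finset.sum_le_sum_of_subset_of_nonneg (f := fun e => - v e) h
    (fun e _ _ => by simpa using hv e)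
  simpa [Finset.sum_neg_distrib] using this

lemma GoodSplit.mono {m : ℕ} {v : Fin m → ℝ} (hv : ∀ e, v e ≤ 0) {t : ℝ} :
    ∀ (k s s' : ℕ), s ≤ s' → GoodSplit v t k s → GoodSplit v t k s'
  | 0, s, s', h, hg => le_trans (show m ≤ s from hg) h
  | k + 1, s, s', h, hg => by
    obtain ⟨c, hc, hval, hg⟩ := hg
    refine ⟨max c s', le_max_right _ _, hval.trans (bundleVal_anti hv ?_),
      GoodSplit.mono hv k c _ (le_max_left _ _) hg⟩
    intro e he
    rw [mem_ivl] at *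
    omega

lemma goodSplit_of_cover {m : ℕ} {ι : Type*} [DecidableEq ι] {v : Fin m → ℝ}
    (hv : ∀ e, v e ≤ 0) {t : ℝ} (A : ι → Finset (Fin m)) (hA : ∀ i, IsConnBundle (A i))
    (ht : ∀ i, t ≤ bundleVal v (A i)) :
    ∀ (k : ℕ) (J : Finset ι) (s : ℕ), J.card = k →
      (∀ e : Fin m, s ≤ e.val → ∃ i ∈ J, e ∈ A i) → GoodSplit v t k s := by
  intro k
  induction k with
  | zero =>
    intro J s hJ hc
    show m ≤ s
    by_contra hlt
    obtain ⟨i, hi, _⟩ := hc ⟨s, by omega⟩ le_rfl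
    rw [Finset.card_eq_zero] at hJ
    simp [hJ] at hi
  | succ k ih =>
    intro J s hJ hc
    by_cases hs : m ≤ s
    · obtain ⟨j, hj⟩ : J.Nonempty := Finset.card_pos.mp (by omega)
      refine ⟨s, le_rfl, (ht j).trans (bundleVal_anti hv ?_), ih (J.erase j) s ?_ ?_⟩
      · intro e he
        rw [mem_ivl] at he
        omega
      · rw [Finset.card_erase_of_mem hj]; omega
      · intro e he
        have := e.isLt
        omega
    · obtain ⟨j, hj, hmem⟩ := hc ⟨s, by omega⟩ le_rfl
      obtain ⟨x, hx, hmax⟩ := Finset.exists_max_image (A j) (fun e => e.val) ⟨_, hmem⟩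
      have hsx : s ≤ x.val := hmax _ hmem
      refine ⟨x.val + 1, by omega, (ht j).trans (bundleVal_anti hv ?_),
        ih (J.erase j) _ ?_ ?_⟩
      · intro e he
        rw [mem_ivl] at he
        exact hA j _ hmem x hx e (Fin.le_def.mpr he.1) (Fin.le_def.mpr (by omega))
      · rw [Finset.card_erase_of_mem hj]; omega
      · intro e he
        obtain ⟨i, hi, hei⟩ := hc e (by omega)
        refine ⟨i, Finset.mem_erase.mpr ⟨?_, hi⟩, hei⟩
        rintro rfl
        have := hmax e hei
        omega

lemma alloc_of_goodSplit {m : ℕ} {ι : Type*} [DecidableEq ι] {v : ι → Fin m → ℝ}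
    (hv : ∀ i e, v i e ≤ 0) (t : ι → ℝ) :
    ∀ (k : ℕ) (J : Finset ι) (s : ℕ), J.card = k →
      (∀ i ∈ J, GoodSplit (v i) (t i) k s) →
      ∃ A : ι → Finset (Fin m), (∀ i, IsConnBundle (A i)) ∧
        (∀ i j, i ≠ j → Disjoint (A i) (A j)) ∧
        (∀ i, ∀ e ∈ A i, s ≤ e.val) ∧
        (∀ i, i ∉ J → A i = ∅) ∧
        (J.Nonempty → ∀ e : Fin m, s ≤ e.val → ∃ i, e ∈ A i) ∧
        (∀ i ∈ J, t i ≤ bundleVal (v i) (A i)) := by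
  intro k
  induction k with
  | zero =>
    intro J s hJ _
    rw [Finset.card_eq_zero] at hJ
    subst hJ
    exact ⟨fun _ => ∅, by simp [IsConnBundle], by simp, by simp, by simp, by simp, by simp⟩
  | succ k ih =>
    intro J s hJ hg
    have hne : J.Nonempty := Finset.card_pos.mp (by omega)
    choose! c hsc hval hrest using hg
    obtain ⟨j, hj, hmax⟩ := Finset.exists_max_image J c hne
    have hcard : (J.erase j).card = k := by rw [Finset.card_erase_of_mem hj]; omega
    obtain ⟨A, h1, h2, h3, h4, h5, h6⟩ := ih (J.erase j) (c j) hcard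
      (fun i hi => GoodSplit.mono (hv i) _ _ _ (hmax i (Finset.mem_of_mem_erase hi))
        (hrest i (Finset.mem_of_mem_erase hi)))
    have hdis : ∀ i, Disjoint (ivl m s (c j)) (A i) := by
      intro i
      rw [Finset.disjoint_left]
      intro e he he'
      rw [mem_ivl] at he
      have := h3 i e he'
      omega
    refine ⟨Function.update A j (ivl m s (c j)), ?_, ?_, ?_, ?_, ?_, ?_⟩
    · intro i
      by_cases h : i = j
      · subst h
        rw [Function.update_self]
        intro a ha d hd b hab hbd
        rw [mem_ivl] at *
        rw [Fin.le_def] at *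
        omega
      · rw [Function.update_of_ne h]; exact h1 i
    · intro i i' hii
      by_cases h : i = j
      · subst h
        rw [Function.update_self, Function.update_of_ne hii.symm]
        exact hdis _
      · rw [Function.update_of_ne h]
        by_cases h' : i' = j
        · subst h'
          rw [Function.update_self]
          exact (hdis _).symm
        · rw [Function.update_of_ne h']
          exact h2 _ _ hii
    · intro i e he
      by_cases h : i = j
      · subst h
        rw [Function.update_self, mem_ivl] at he
        exact he.1
      · rw [Function.update_of_ne h] at he
        exact (hsc j hj).trans (h3 i e he)
    · intro i hi
      have h : i ≠ j := fun h => hi (h ▸ hj)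
      rw [Function.update_of_ne h]
      exact h4 i (fun h' => hi (Finset.mem_of_mem_erase h'))
    · intro _ e he
      by_cases hec : e.val < c j
      · exact ⟨j, by rw [Function.update_self, mem_ivl]; exact ⟨he, hec⟩⟩
      · rcases Nat.eq_zero_or_pos k with hk | hk
        · subst hk
          have : m ≤ c j := hrest j hj
          have := e.isLt
          omega
        · obtain ⟨i, hi⟩ := h5 (Finset.card_pos.mp (by omega)) e (by omega)
          have h : i ≠ j := by
            rintro rfl
            rw [h4 i (by simp)] at hi
            simp at hi
          exact ⟨i, by rw [Function.update_of_ne h]; exact hi⟩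
    · intro i hi
      by_cases h : i = j
      · subst h
        rw [Function.update_self]
        exact hval i hi
      · rw [Function.update_of_ne h]
        exact h6 i (Finset.mem_erase.mpr ⟨h, hi⟩)

lemma mmsVal_attained (n m : ℕ) (hn : 1 ≤ n) (v : Fin m → ℝ) :
    ∃ A : Fin n → Finset (Fin m), ConnAlloc n m A ∧ ∀ j, mmsVal n m v ≤ bundleVal v (A j) := by
  have hfin : { x : ℝ | ∃ A : Fin n → Finset (Fin m), ConnAlloc n m A ∧
      x = ⨅ j, bundleVal v (A j) }.Finite := by
    refine (Set.finite_range
      (fun A : Fin n → Finset (Fin m) => ⨅ j, bundleVal v (A j))).subset ?_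
    rintro x ⟨A, _, rfl⟩
    exact ⟨A, rfl⟩
  have hne : { x : ℝ | ∃ A : Fin n → Finset (Fin m), ConnAlloc n m A ∧
      x = ⨅ j, bundleVal v (A j) }.Nonempty := by
    refine ⟨_, fun i => if i = ⟨0, hn⟩ then Finset.univ else ∅, ⟨?_, ?_, ?_⟩, rfl⟩
    · intro i
      dsimp only
      split_ifs <;> simp [IsConnBundle]
    · intro i j hij
      dsimp only
      split_ifs with h h'
      · exact absurd (h.trans h'.symm) hij
      all_goals simp
    · intro e
      exact ⟨⟨0, hn⟩, by simp⟩
  obtain ⟨A, hA, hx⟩ := hne.csSup_mem hfin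
  refine ⟨A, hA, fun j => ?_⟩
  unfold mmsVal
  rw [hx]
  exact ciInf_le (Set.finite_range _).bddBelow j

/-- Every fair-chores instance with items on a line admits a connected
MMS allocation. -/
theorem chores_mms_exists (n m : ℕ) (hn : 1 ≤ n)
    (v : Fin n → Fin m → ℝ)
    (hneg : ∀ i j, v i j ≤ 0)
    (hnorm : ∀ i, bundleVal (v i) Finset.univ = -1) :
    ∃ A : Fin n → Finset (Fin m), ConnAlloc n m A ∧
      ∀ i, mmsVal n m (v i) ≤ bundleVal (v i) (A i) := by
  have hg : ∀ i ∈ (Finset.univ : Finset (Fin n)),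
      GoodSplit (v i) (mmsVal n m (v i)) n 0 := by
    intro i _
    obtain ⟨A, hA, ht⟩ := mmsVal_attained n m hn (v i)
    refine goodSplit_of_cover (hneg i) A hA.1 ht n Finset.univ 0 (by simp) ?_
    intro e _
    obtain ⟨j, hj⟩ := hA.2.2 e
    exact ⟨j, Finset.mem_univ _, hj⟩
  obtain ⟨A, h1, h2, -, -, h5, h6⟩ :=
    alloc_of_goodSplit hneg (fun i => mmsVal n m (v i)) n Finset.univ 0 (by simp) hg
  exact ⟨A, ⟨h1, h2, fun e => h5 ⟨⟨0, hn⟩, Finset.mem_univ _⟩ e (Nat.zero_le _)⟩,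
    fun i => h6 i (Finset.mem_univ _)⟩
end
end

section
/- For every fair-chores instance with n >= 3 agents, there exists a connected PROP1 allocation A with utilitarian welfare UW(A) >= -3. Consequently the price of PROP1 with respect to utilitarian welfare for chores is at most 3n. -/
open Finset

noncomputable section

/-- A connected allocation of chores is PROP1 if every agent's bundle is either empty or
contains an item whose removal keeps the bundle connected and brings the agent's value
up to at least `-1/n`. -/
def Prop1Chores (n m : ℕ) (v : Fin n → Fin m → ℝ) (A : Fin n → Finset (Fin m)) : Prop :=
  ∀ i, A i = ∅ ∨ ∃ e ∈ A i, IsConnBundle (A i \ {e}) ∧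
    -(1 / (n : ℝ)) ≤ bundleVal (v i) (A i \ {e})

/-- The interval `[L, U)` is acceptable for a prefix-cost function `P` at level `a`. -/
def OkInt (P : ℕ → ℝ) (a : ℝ) (L U : ℕ) : Prop :=
  L = U ∨ P U - P (L + 1) ≤ a ∨ ∃ U', U = U' + 1 ∧ L ≤ U' ∧ P U' - P L ≤ a

/-- Invariant: `l` still has at most its share left, or is one share in debt but faces
a first item of cost at least two shares. -/
def ShareInv (P : ℕ → ℝ) (a : ℝ) (m p K : ℕ) : Prop :=
  P m - P p ≤ K * a ∨ (p < m ∧ P m - P p ≤ (K + 1) * a ∧ 2 * a ≤ P (p + 1) - P p)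

theorem step_lemma {ι : Type*} [DecidableEq ι] (P : ι → ℕ → ℝ) (hP : ∀ i, Monotone (P i))
    (a : ℝ) (ha : 0 < a) (m p K : ℕ) (hp : p ≤ m) (R : Finset ι) (hR : R.Nonempty)
    (hI : ∀ l ∈ R, ShareInv (P l) a m p (K + 1)) :
    (∃ i ∈ R, OkInt (P i) a p m) ∨
    ∃ i ∈ R, ∃ q, p ≤ q ∧ q ≤ m ∧ OkInt (P i) a p q ∧
      ∀ l ∈ R.erase i, P i q - P i p ≤ 2 * a + (P l q - P l p) ∧ ShareInv (P l) a m q K := by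
  obtain ⟨r, hr⟩ := hR
  rcases Nat.eq_or_lt_of_le hp with rfl | hpm
  · exact Or.inl ⟨r, hr, Or.inl rfl⟩
  classical
  let Q := (Finset.Icc p m).filter (fun q => ∃ l ∈ R, P l q - P l p ≤ a)
  have hQ : Q.Nonempty := ⟨p, by
    simp only [Q, Finset.mem_filter, Finset.mem_Icc]
    exact ⟨⟨le_rfl, hp⟩, r, hr, by simpa using ha.le⟩⟩
  obtain ⟨q, hq, hmax⟩ := Q.exists_max_image id hQ
  simp only [Q, Finset.mem_filter, Finset.mem_Icc, id] at hq hmax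
  obtain ⟨⟨hpq, hqm⟩, l0, hl0, hl0a⟩ := hq
  rcases Nat.eq_or_lt_of_le hqm with rfl | hqm'
  · left
    refine ⟨l0, hl0, Or.inr (Or.inl ?_)⟩
    have := hP l0 (Nat.le_succ p)
    simp only [Nat.succ_eq_add_one] at this
    linarith
  have hbig : ∀ l ∈ R, a < P l (q + 1) - P l p := by
    intro l hl
    by_contra! h
    have := hmax (q + 1) ⟨⟨by omega, by omega⟩, l, hl, h⟩
    omega
  obtain ⟨i, hi, himin⟩ := (R.filter (fun l => P l q - P l p ≤ a)).exists_min_image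
    (fun l => P l (q + 1) - P l q) ⟨l0, by exact Finset.mem_filter.mpr ⟨hl0, hl0a⟩⟩
  simp only [Finset.mem_filter] at hi himin
  obtain ⟨hiR, hia⟩ := hi
  right
  refine ⟨i, hiR, ?_⟩
  by_cases hAB : (∀ l ∈ R, P i (q + 1) - P i q ≤ P l (q + 1) - P l q) ∨
      P i (q + 1) - P i q < 2 * a
  · refine ⟨q + 1, by omega, by omega, Or.inr (Or.inr ⟨q, rfl, hpq, hia⟩), ?_⟩
    intro l hl
    have hlR := Finset.mem_of_mem_erase hl
    have h1 := hbig l hlR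
    have h2 := hP l hpq
    refine ⟨?_, ?_⟩
    · rcases hAB with h | h
      · have := h l hlR
        linarith
      · linarith
    · left
      have h3 : P l (p + 1) ≤ P l (q + 1) := hP l (by omega)
      rcases hI l hlR with h | ⟨_, h, h'⟩ <;> push_cast at h <;> linarith
  · push Not at hAB
    obtain ⟨⟨j, hj, hjlt⟩, h2a⟩ := hAB
    have hpq' : p < q := by
      rcases Nat.eq_or_lt_of_le hpq with rfl | h
      · have := himin j ⟨hj, by simpa using ha.le⟩
        linarith
      · exact h
    refine ⟨q, hpq, hqm, Or.inr (Or.inl ?_), ?_⟩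
    · have : P i p ≤ P i (p + 1) := hP i (by omega)
      linarith
    intro l hl
    have hlR := Finset.mem_of_mem_erase hl
    have h2 := hP l hpq
    refine ⟨by linarith, ?_⟩
    have h3 : P l (p + 1) ≤ P l q := hP l (by omega)
    rcases hI l hlR with h | ⟨_, h, h'⟩
    · push_cast at h
      by_cases ht : P l q - P l p ≤ a
      · right
        have := himin l ⟨hlR, ht⟩
        exact ⟨hqm', by linarith, by linarith⟩
      · left
        linarith
    · push_cast at h
      left
      linarith

theorem main_lemma {ι : Type*} [DecidableEq ι] (P : ι → ℕ → ℝ) (hP : ∀ i, Monotone (P i))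
    (a : ℝ) (ha : 0 < a) (m : ℕ) : ∀ (K p : ℕ), p ≤ m → ∀ R : Finset ι, R.card = K + 1 →
    (∀ l ∈ R, ShareInv (P l) a m p (K + 1)) →
    ∃ L U : ι → ℕ, (∀ i ∈ R, p ≤ L i ∧ L i ≤ U i ∧ U i ≤ m ∧ OkInt (P i) a (L i) (U i)) ∧
      (∀ i ∈ R, ∀ j ∈ R, i ≠ j → U i ≤ L j ∨ U j ≤ L i) ∧
      (∀ x, p ≤ x → x < m → ∃ i ∈ R, L i ≤ x ∧ x < U i) ∧
      ∃ l ∈ R, ∑ i ∈ R, (P i (U i) - P i (L i)) ≤ P l m - P l p + 2 * a * K := by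
  have finish : ∀ (K p : ℕ), p ≤ m → ∀ R : Finset ι, (∃ i ∈ R, OkInt (P i) a p m) →
    ∃ L U : ι → ℕ, (∀ i ∈ R, p ≤ L i ∧ L i ≤ U i ∧ U i ≤ m ∧ OkInt (P i) a (L i) (U i)) ∧
      (∀ i ∈ R, ∀ j ∈ R, i ≠ j → U i ≤ L j ∨ U j ≤ L i) ∧
      (∀ x, p ≤ x → x < m → ∃ i ∈ R, L i ≤ x ∧ x < U i) ∧
      ∃ l ∈ R, ∑ i ∈ R, (P i (U i) - P i (L i)) ≤ P l m - P l p + 2 * a * K := by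
    rintro K p hp R ⟨i, hi, hok⟩
    refine ⟨fun j => if j = i then p else m, fun _ => m, ?_, ?_, ?_, i, hi, ?_⟩
    · intro j hj
      by_cases h : j = i
      · subst h; simp [hp, hok]
      · simp [h, hp, OkInt]
    · intro j hj j' hj' hne
      by_cases h : j = i
      · left; subst h; simp [hne.symm]
      · right; simp [h]
    · intro x hx hxm
      exact ⟨i, hi, by simpa using hx, hxm⟩
    · rw [Finset.sum_eq_single i]
      · simp only [if_true]
        have : 0 ≤ 2 * a * K := by positivity
        linarith
      · intro j _ hj; simp [hj]
      · intro h; exact absurd hi h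
  intro K
  induction K with
  | zero =>
    intro p hp R hR hI
    apply finish 0 p hp R
    obtain ⟨i, rfl⟩ := Finset.card_eq_one.mp hR
    refine ⟨i, by simp, ?_⟩
    have h0 : P i p ≤ P i (p + 1) := hP i (by omega)
    right; left
    rcases hI i (by simp) with h | ⟨_, h, h'⟩ <;> push_cast at h <;> linarith
  | succ K ih =>
    intro p hp R hR hI
    rcases step_lemma P hP a ha m p (K + 1) hp R (Finset.card_pos.mp (by omega)) hI with h | h
    · exact finish _ p hp R h
    obtain ⟨i, hi, q, hpq, hqm, hok, hrest⟩ := h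
    obtain ⟨L, U, h1, h2, h3, l, hl, h4⟩ := ih q hqm (R.erase i)
      (by rw [Finset.card_erase_of_mem hi]; omega) (fun l hl => (hrest l hl).2)
    refine ⟨Function.update L i p, Function.update U i q, ?_, ?_, ?_, l,
      Finset.mem_of_mem_erase hl, ?_⟩
    · intro j hj
      by_cases h : j = i
      · subst h; simp [hpq, hqm, hok]
      · have := h1 j (Finset.mem_erase.mpr ⟨h, hj⟩)
        simp only [Function.update_of_ne h]
        exact ⟨by omega, this.2⟩
    · intro j hj j' hj' hne
      by_cases h : j = i
      · subst h
        left
        have := h1 j' (Finset.mem_erase.mpr ⟨hne.symm, hj'⟩)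
        simp only [Function.update_self, Function.update_of_ne hne.symm]
        exact this.1
      · by_cases h' : j' = i
        · subst h'
          right
          have := h1 j (Finset.mem_erase.mpr ⟨hne, hj⟩)
          simp only [Function.update_self, Function.update_of_ne hne]
          exact this.1
        · simp only [Function.update_of_ne h, Function.update_of_ne h']
          exact h2 j (Finset.mem_erase.mpr ⟨h, hj⟩) j' (Finset.mem_erase.mpr ⟨h', hj'⟩) hne
    · intro x hx hxm
      by_cases hxq : x < q
      · exact ⟨i, hi, by simpa using hx, by simpa using hxq⟩
      · obtain ⟨j, hj, hj'⟩ := h3 x (by omega) hxm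
        have hne := Finset.ne_of_mem_erase hj
        refine ⟨j, Finset.mem_of_mem_erase hj, ?_⟩
        simpa only [Function.update_of_ne hne] using hj'
    · rw [← Finset.add_sum_erase _ _ hi]
      have : ∑ x ∈ R.erase i, (P x (Function.update U i q x) - P x (Function.update L i p x))
          = ∑ x ∈ R.erase i, (P x (U x) - P x (L x)) := by
        apply Finset.sum_congr rfl
        intro x hx
        have hne := Finset.ne_of_mem_erase hx
        simp only [Function.update_of_ne hne]
      rw [this]
      simp only [Function.update_self]
      have := (hrest l hl).1
      push_cast
      linarith

/-- Prefix cost. -/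
def prefCost {m : ℕ} (v : Fin m → ℝ) (k : ℕ) : ℝ :=
  ∑ e ∈ Finset.univ.filter (fun e : Fin m => e.val < k), - v e

/-- The interval `[L, U)` of items. -/
def seg (m L U : ℕ) : Finset (Fin m) := Finset.univ.filter (fun e => L ≤ e.val ∧ e.val < U)

theorem mem_seg {m L U : ℕ} (e : Fin m) : e ∈ seg m L U ↔ L ≤ e.val ∧ e.val < U := by
  simp [seg]

theorem seg_conn (m L U : ℕ) : IsConnBundle (seg m L U) := by
  intro a ha c hc b hab hbc
  rw [mem_seg] at *
  rw [Fin.le_def] at hab hbc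
  omega

theorem prefCost_mono {m : ℕ} (v : Fin m → ℝ) (hv : ∀ j, v j ≤ 0) : Monotone (prefCost v) := by
  intro a b hab
  apply Finset.sum_le_sum_of_subset_of_nonneg
  · intro e he
    simp only [Finset.mem_filter, Finset.mem_univ, true_and] at *
    omega
  · intro e _ _
    linarith [hv e]

theorem seg_val {m : ℕ} (v : Fin m → ℝ) {L U : ℕ} (h : L ≤ U) :
    bundleVal v (seg m L U) = - (prefCost v U - prefCost v L) := by
  have hs : Finset.univ.filter (fun e : Fin m => e.val < U) =
      Finset.univ.filter (fun e : Fin m => e.val < L) ∪ seg m L U := by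
    ext e
    simp only [Finset.mem_filter, Finset.mem_univ, true_and, Finset.mem_union, mem_seg]
    omega
  have hd : Disjoint (Finset.univ.filter (fun e : Fin m => e.val < L)) (seg m L U) := by
    rw [Finset.disjoint_left]
    intro e he he'
    simp only [Finset.mem_filter, Finset.mem_univ, true_and, mem_seg] at *
    omega
  unfold prefCost bundleVal
  rw [hs, Finset.sum_union hd]
  simp

/-- For every fair-chores instance with `n ≥ 3` agents, there exists a
connected PROP1 allocation with utilitarian welfare at least `-3`. -/
theorem chores_utilitarian_prop1_exists (n m : ℕ) (hn : 3 ≤ n)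
    (v : Fin n → Fin m → ℝ)
    (hneg : ∀ i j, v i j ≤ 0)
    (hnorm : ∀ i, bundleVal (v i) Finset.univ = -1) :
    ∃ A : Fin n → Finset (Fin m), ConnAlloc n m A ∧ Prop1Chores n m v A ∧
      (-3 : ℝ) ≤ utilW n m v A := by
  obtain ⟨K, rfl⟩ : ∃ K, n = K + 1 := ⟨n - 1, by omega⟩
  have hn0 : (0 : ℝ) < ((K + 1 : ℕ) : ℝ) := by positivity
  have hP0 : ∀ i, prefCost (v i) 0 = 0 := by intro i; simp [prefCost]
  have hPm : ∀ i, prefCost (v i) m = 1 := by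
    intro i
    have h1 := seg_val (v i) (Nat.zero_le m)
    have h2 : seg m 0 m = Finset.univ := by ext e; simp [mem_seg]
    rw [h2, hnorm, hP0] at h1
    linarith
  set a : ℝ := 1 / ((K + 1 : ℕ) : ℝ) with ha
  have hapos : 0 < a := by positivity
  have hKa : ((K + 1 : ℕ) : ℝ) * a = 1 := by rw [ha]; field_simp
  obtain ⟨L, U, h1, h2, h3, l, -, h4⟩ := main_lemma (fun i => prefCost (v i))
    (fun i => prefCost_mono _ (hneg i)) a hapos m K 0 (Nat.zero_le _) Finset.univ (by simp)
    (by
      intro l _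
      left
      rw [hPm, hP0, hKa]
      norm_num)
  refine ⟨fun i => seg m (L i) (U i), ⟨fun i => seg_conn _ _ _, ?_, ?_⟩, ?_, ?_⟩
  · intro i j hij
    rw [Finset.disjoint_left]
    intro e he he'
    rw [mem_seg] at he he'
    have := h2 i (Finset.mem_univ _) j (Finset.mem_univ _) hij
    omega
  · intro e
    obtain ⟨i, -, hi⟩ := h3 e.val (Nat.zero_le _) e.isLt
    exact ⟨i, (mem_seg e).2 hi⟩
  · intro i
    obtain ⟨-, hLU, hUm, hok⟩ := h1 i (Finset.mem_univ _)
    rcases Nat.eq_or_lt_of_le hLU with h | hlt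
    · left
      ext e
      simp only [mem_seg, Finset.notMem_empty, iff_false]
      omega
    right
    rcases hok with h | h | ⟨U', hU', hLU', h⟩
    · omega
    · refine ⟨⟨L i, by omega⟩, (mem_seg _).2 ⟨le_rfl, hlt⟩, ?_⟩
      have hs : seg m (L i) (U i) \ {⟨L i, by omega⟩} = seg m (L i + 1) (U i) := by
        ext e
        simp only [Finset.mem_sdiff, Finset.mem_singleton, mem_seg, Fin.ext_iff]
        omega
      rw [hs, seg_val _ (by omega)]
      exact ⟨seg_conn _ _ _, by linarith⟩
    · refine ⟨⟨U', by omega⟩, (mem_seg _).2 ⟨hLU', by simp only; omega⟩, ?_⟩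
      have hs : seg m (L i) (U i) \ {⟨U', by omega⟩} = seg m (L i) U' := by
        ext e
        simp only [Finset.mem_sdiff, Finset.mem_singleton, mem_seg, Fin.ext_iff]
        omega
      rw [hs, seg_val _ hLU']
      exact ⟨seg_conn _ _ _, by linarith⟩
  · unfold utilW
    have : ∑ i, bundleVal (v i) (seg m (L i) (U i)) =
        - ∑ i, (prefCost (v i) (U i) - prefCost (v i) (L i)) := by
      rw [← Finset.sum_neg_distrib]
      exact Finset.sum_congr rfl fun i hi => seg_val _ (h1 i hi).2.1
    rw [this]
    simp only [hPm, hP0] at h4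
    push_cast at hKa
    linarith
end
end

section
/- For every fair-chores instance with n = 3 agents, there exists a connected PROP1 allocation A with EW(A) >= 2 * OPT_E; and for every fair-chores instance with n >= 4 agents, there exists a connected PROP1 allocation A with EW(A) >= (n/2) * OPT_E (note OPT_E <= 0, so these say the egalitarian-welfare loss factor of PROP1 is at most 2 for n = 3 and at most n/2 for n >= 4). -/
open Finset

noncomputable section

/-- Acceptable interval `[lo,hi)` in terms of the suffix cost function `T`. -/
def AccI (L θ : ℝ) (T : ℕ → ℝ) (lo hi : ℕ) : Prop :=
  lo < hi → T lo - T hi ≤ L ∧ (T lo - T (hi - 1) ≤ θ ∨ T (lo + 1) - T hi ≤ θ)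

/-- An acceptable allocation of the items in `D` to the agents of `R`. -/
def AllocI {ι : Type} (L θ : ℝ) (T : ι → ℕ → ℝ) (D : Set ℕ) (R : Finset ι) : Prop :=
  ∃ f : ℕ → ι, (∀ x ∈ D, f x ∈ R) ∧ ∀ k ∈ R, ∃ lo hi : ℕ,
    (∀ x, (x ∈ D ∧ f x = k) ↔ (lo ≤ x ∧ x < hi)) ∧ AccI L θ (T k) lo hi

theorem AllocI.extend {ι : Type} [DecidableEq ι] {L θ : ℝ} {T : ι → ℕ → ℝ} {D D' : Set ℕ}
    {R : Finset ι} {g : ι} {a b : ℕ} (hg : g ∈ R)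
    (h : AllocI L θ T D (R.erase g)) (hacc : AccI L θ (T g) a b)
    (hD : ∀ x, x ∈ D' ↔ (x ∈ D ∨ (a ≤ x ∧ x < b)))
    (hdisj : ∀ x ∈ D, ¬ (a ≤ x ∧ x < b)) : AllocI L θ T D' R := by
  obtain ⟨f, hf, hk⟩ := h
  refine ⟨fun x => if a ≤ x ∧ x < b then g else f x, ?_, ?_⟩
  · intro x hx
    by_cases hab : a ≤ x ∧ x < b
    · simp [hab, hg]
    · simp only [hab, if_false]
      exact Finset.mem_of_mem_erase (hf x (((hD x).1 hx).resolve_right hab))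
  · intro k hkR
    by_cases hkg : k = g
    · subst hkg
      refine ⟨a, b, ?_, hacc⟩
      intro x
      by_cases hab : a ≤ x ∧ x < b
      · simp [hab, hD]
      · simp only [hab, if_false, iff_false]
        rintro ⟨h1, h2⟩
        have := hf x (((hD x).1 h1).resolve_right hab)
        rw [h2] at this
        simp at this
    · obtain ⟨lo, hi, h1, h2⟩ := hk k (Finset.mem_erase.2 ⟨hkg, hkR⟩)
      refine ⟨lo, hi, ?_, h2⟩
      intro x
      rw [← h1]
      by_cases hab : a ≤ x ∧ x < b
      · simp only [hab, and_self, if_true]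
        constructor
        · rintro ⟨_, h⟩; exact absurd h.symm hkg
        · rintro ⟨h, _⟩; exact absurd hab (hdisj x h)
      · simp only [hab, if_false, hD, or_false]

theorem AllocI.empty {ι : Type} {L θ : ℝ} {T : ι → ℕ → ℝ} {D : Set ℕ}
    {R : Finset ι} (g : ι) (hD : ∀ x, x ∉ D) : AllocI L θ T D R := by
  refine ⟨fun _ => g, fun x hx => absurd hx (hD x), fun k _ => ⟨0, 0, ?_, ?_⟩⟩
  · intro x; simp [hD]
  · intro h; omega

theorem step_lemma_s17 {ι : Type} [DecidableEq ι] {L θ : ℝ} {T : ι → ℕ → ℝ} (hθ : 0 ≤ θ)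
    (hL : 2 * θ ≤ L)
    {R : Finset ι} {p e : ℕ} (hpe : p < e) (r : ℝ)
    (hst : ∀ k ∈ R, T k p ≤ r * θ ∨ T k (p + 1) ≤ (r - 1) * θ)
    (hown : ∃ g ∈ R, T g p - T g (p + 1) ≤ L) :
    ∃ g ∈ R, ∃ q, p < q ∧ q ≤ e ∧ T g p - T g q ≤ L ∧ T g p - T g (q - 1) ≤ θ ∧
      ∀ k ∈ R, (∀ x y, x ≤ y → T k y ≤ T k x) →
        T k q ≤ (r - 1) * θ ∨ T k (q + 1) ≤ (r - 2) * θ ∨ q = e := by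
  classical
  by_cases hall : ∀ k ∈ R, T k (p + 1) ≤ (r - 1) * θ
  · obtain ⟨g, hg, hgL⟩ := hown
    exact ⟨g, hg, p + 1, by omega, by omega, hgL, by simpa using hθ,
      fun k hk _ => Or.inl (hall k hk)⟩
  push Not at hall
  obtain ⟨g0, hg0, hg0'⟩ := hall
  have hex : ∃ q, p < q ∧ ∀ k ∈ R, (r - 1) * θ < T k (p + 1) →
      (e ≤ q ∨ θ ≤ T k p - T k q ∨ 2 * θ ≤ T k p - T k (q + 1)) :=
    ⟨e, hpe, fun k _ _ => Or.inl le_rfl⟩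
  set q := Nat.find hex with hq
  obtain ⟨hpq, hqk⟩ := Nat.find_spec hex
  rw [← hq] at hpq hqk
  have hqe : q ≤ e := Nat.find_min' hex ⟨hpe, fun k _ _ => Or.inl le_rfl⟩
  have hfin : ∀ k ∈ R, (∀ x y, x ≤ y → T k y ≤ T k x) →
        T k q ≤ (r - 1) * θ ∨ T k (q + 1) ≤ (r - 2) * θ ∨ q = e := by
    intro k hk hm
    by_cases hb : T k (p + 1) ≤ (r - 1) * θ
    · left; exact (hm _ _ hpq).trans hb
    · have ha := (hst k hk).resolve_right hb
      push Not at hb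
      rcases hqk k hk hb with h | h | h
      · right; right; omega
      · left; linarith
      · right; left; linarith
  by_cases hq1 : q = p + 1
  · refine ⟨g0, hg0, q, hpq, hqe, ?_, ?_, hfin⟩
    · have := (hst g0 hg0).resolve_right (not_le.2 hg0')
      rw [hq1]; linarith
    · rw [hq1]; simpa using hθ
  · have hmin := Nat.find_min hex (m := q - 1) (by omega)
    push Not at hmin
    obtain ⟨g, hg, _, h1, h2, h3⟩ := hmin (by omega)
    rw [Nat.sub_add_cancel (by omega)] at h3
    exact ⟨g, hg, q, hpq, hqe, by linarith, h2.le, hfin⟩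

theorem main_alloc {ι : Type} [DecidableEq ι] {L θ : ℝ} {T : ι → ℕ → ℝ} {m : ℕ} (hθ : 0 < θ)
    (hL : 2 * θ ≤ L) (hL2 : 1 / 2 ≤ L)
    (hT0 : ∀ k, T k 0 ≤ 1) (hTm : ∀ k x, m ≤ x → T k x = 0)
    (hanti : ∀ k x y, x ≤ y → T k y ≤ T k x) (N : ℕ) :
    (∀ (R : Finset ι) (p : ℕ), R.card = N → R.Nonempty →
      (∀ k ∈ R, T k p ≤ (N : ℝ) * θ ∨ T k (p + 1) ≤ ((N : ℝ) - 1) * θ) →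
      (∀ j, p ≤ j → j < m → ∃ g ∈ R, T g j - T g (j + 1) ≤ L) →
      AllocI L θ T {x | p ≤ x ∧ x < m} R) ∧
    (∀ (R : Finset ι) (p j : ℕ), R.card = N → R.Nonempty → p < j → j < m →
      (∀ k ∈ R, T k p ≤ ((N : ℝ) + 1) * θ ∨ T k (p + 1) ≤ (N : ℝ) * θ) →
      (∀ k ∈ R, L < T k j - T k (j + 1)) →
      AllocI L θ T {x | p ≤ x ∧ x < m ∧ x ≠ j} R) := by
  induction N using Nat.strong_induction_on with
  | _ N ih =>
  have hnn : ∀ k x, 0 ≤ T k x := by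
    intro k x
    have := hanti k x (x + m) (by omega)
    rw [hTm k (x + m) (by omega)] at this
    exact this
  constructor
  · intro R p hcard hne hst hown
    obtain ⟨g0, hg0⟩ := hne
    by_cases hpm : m ≤ p
    · exact AllocI.empty g0 (by rintro x ⟨h1, h2⟩; omega)
    push Not at hpm
    have hNpos : 0 < N := by rw [← hcard]; exact Finset.card_pos.2 ⟨g0, hg0⟩
    by_cases hN1 : N = 1
    · -- single agent takes everything
      subst hN1
      obtain ⟨a, ha⟩ := Finset.card_eq_one.1 hcard
      subst ha
      simp only [Finset.mem_singleton] at hg0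
      subst hg0
      refine AllocI.extend (D := ∅) (g := g0) (a := p) (b := m) (by simp)
        (AllocI.empty g0 (by simp)) ?_ (by simp) (by simp)
      intro _
      have h0 := hTm g0 m le_rfl
      obtain ⟨g, hg, hgL⟩ := hown p le_rfl hpm
      simp only [Finset.mem_singleton] at hg
      subst hg
      have hs := hst g (by simp)
      rw [h0]
      push_cast at hs
      rcases hs with hs | hs
      · have := hanti g p (p + 1) (by omega)
        constructor
        · linarith
        · right; linarith
      · constructor
        · linarith
        · right; linarith
    obtain ⟨g, hg, q, hpq, hqe, hc1, hc2, hk⟩ :=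
      step_lemma_s17 hθ.le hL hpm (N : ℝ) hst (hown p le_rfl hpm)
    have hce : (R.erase g).card = N - 1 := by rw [Finset.card_erase_of_mem hg, hcard]
    have hne' : (R.erase g).Nonempty := by rw [← Finset.card_pos, hce]; omega
    have hcast : ((N - 1 : ℕ) : ℝ) = (N : ℝ) - 1 := by
      rw [Nat.cast_sub (by omega)]; simp
    by_cases hbr : ∀ j, q ≤ j → j < m → ∃ h ∈ R.erase g, T h j - T h (j + 1) ≤ L
    · have := (ih (N - 1) (by omega)).1 (R.erase g) q hce hne' (by
        intro k hkR
        rw [hcast]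
        rcases hk k (Finset.mem_of_mem_erase hkR) (hanti k) with h | h | h
        · left; exact h
        · right; linarith
        · left
          rw [h, hTm k m le_rfl, ← hcast]
          positivity) hbr
      refine AllocI.extend hg this (a := p) (b := q) (fun _ => ⟨hc1, Or.inl hc2⟩) ?_ ?_
      · intro x; simp only [Set.mem_ofPred_eq]; omega
      · intro x; simp only [Set.mem_ofPred_eq]; omega
    · push Not at hbr
      obtain ⟨j, hqj, hjm, hj⟩ := hbr
      have := (ih (N - 1) (by omega)).2 (R.erase g) p j hce hne' (by omega) hjm (by
        intro k hkR
        rw [hcast]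
        simpa using hst k (Finset.mem_of_mem_erase hkR)) hj
      refine AllocI.extend hg this (a := j) (b := j + 1) (fun _ => ⟨?_, Or.inl (by simpa using hθ.le)⟩) ?_ ?_
      · obtain ⟨h, hhR, hh⟩ := hown j (by omega) hjm
        by_cases hhg : h = g
        · rwa [hhg] at hh
        · exact absurd hh (not_le.2 (hj h (Finset.mem_erase.2 ⟨hhg, hhR⟩)))
      · intro x; simp only [Set.mem_ofPred_eq]; omega
      · intro x; simp only [Set.mem_ofPred_eq]; omega
  · intro R p j hcard hne hpj hjm hst hj
    have hNpos : 0 < N := by rw [← hcard]; exact Finset.card_pos.2 hne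
    have hsmall : ∀ k ∈ R, ∀ x, x ≠ j → T k x - T k (x + 1) ≤ L := by
      intro k hk x hx
      have h1 := hj k hk
      have h2 := hT0 k
      rcases lt_or_gt_of_ne hx with h | h
      · have := hanti k 0 x (by omega)
        have := hanti k (x + 1) j (by omega)
        have := hnn k (j + 1)
        linarith
      · have := hanti k 0 j (by omega)
        have := hanti k (j + 1) x (by omega)
        have := hnn k (x + 1)
        linarith
    have hN1 : N ≠ 1 := by
      rintro rfl
      obtain ⟨a, ha⟩ := hne
      have h1 := hj a ha
      have h2 := hnn a (j + 1)
      have h3 := hanti a p j (by omega)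
      have h4 := hanti a (p + 1) j (by omega)
      have hs := hst a ha
      push_cast at hs
      rcases hs with hs | hs <;> linarith
    obtain ⟨g0, hg0⟩ := hne
    obtain ⟨g, hg, q, hpq, hqe, hc1, hc2, hk⟩ :=
      step_lemma_s17 hθ.le hL hpj ((N : ℝ) + 1) (R := R) (T := T) (by simpa using hst)
        ⟨g0, hg0, hsmall g0 hg0 p (by omega)⟩
    have hce : (R.erase g).card = N - 1 := by rw [Finset.card_erase_of_mem hg, hcard]
    have hne' : (R.erase g).Nonempty := by rw [← Finset.card_pos, hce]; omega
    have hcast : ((N - 1 : ℕ) : ℝ) = (N : ℝ) - 1 := by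
      rw [Nat.cast_sub (by omega)]; simp
    by_cases hqj : q = j
    · have := (ih (N - 1) (by omega)).1 (R.erase g) (j + 1) hce hne' (by
        intro k hkR
        have hkR' := Finset.mem_of_mem_erase hkR
        rw [hcast]
        left
        have h1 := hj k hkR'
        have h3 := hanti k p j (by omega)
        have h4 := hanti k (p + 1) j (by omega)
        rcases hst k hkR' with h | h <;> linarith) (by
        intro x hx _
        obtain ⟨a, ha⟩ := hne'
        exact ⟨a, ha, hsmall a (Finset.mem_of_mem_erase ha) x (by omega)⟩)
      refine AllocI.extend hg this (a := p) (b := q) (fun _ => ⟨hc1, Or.inl hc2⟩) ?_ ?_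
      · intro x; simp only [Set.mem_ofPred_eq]; omega
      · intro x; simp only [Set.mem_ofPred_eq]; omega
    · have := (ih (N - 1) (by omega)).2 (R.erase g) q j hce hne' (by omega) hjm (by
        intro k hkR
        rw [hcast]
        rcases hk k (Finset.mem_of_mem_erase hkR) (hanti k) with h | h | h
        · left; linarith
        · right; linarith
        · exact absurd h hqj) (fun k hk => hj k (Finset.mem_of_mem_erase hk))
      refine AllocI.extend hg this (a := p) (b := q) (fun _ => ⟨hc1, Or.inl hc2⟩) ?_ ?_
      · intro x; simp only [Set.mem_ofPred_eq]; omega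
      · intro x; simp only [Set.mem_ofPred_eq]; omega

/-- suffix cost -/
def sufCost {m : ℕ} (v : Fin m → ℝ) (a : ℕ) : ℝ :=
  ∑ x : Fin m, if a ≤ x.val then - v x else 0

theorem bundleVal_interval {m : ℕ} (v : Fin m → ℝ) (S : Finset (Fin m)) (lo hi : ℕ)
    (h : lo ≤ hi) (hS : ∀ x : Fin m, x ∈ S ↔ lo ≤ x.val ∧ x.val < hi) :
    bundleVal v S = - (sufCost v lo - sufCost v hi) := by
  have hb : bundleVal v S = ∑ x : Fin m, if x ∈ S then v x else 0 := by
    unfold bundleVal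
    rw [Finset.sum_ite_mem, Finset.univ_inter]
  rw [hb]
  unfold sufCost
  rw [← Finset.sum_sub_distrib, ← Finset.sum_neg_distrib]
  refine Finset.sum_congr rfl fun x _ => ?_
  by_cases h1 : lo ≤ x.val <;> by_cases h2 : hi ≤ x.val
  · have : x ∉ S := by rw [hS]; omega
    simp [h1, h2, this]
  · have : x ∈ S := by rw [hS]; omega
    simp [h1, h2, this]
  · omega
  · have : x ∉ S := by rw [hS]; omega
    simp [h1, h2, this]

theorem isConn_interval {m : ℕ} (S : Finset (Fin m)) (lo hi : ℕ)
    (hS : ∀ x : Fin m, x ∈ S ↔ lo ≤ x.val ∧ x.val < hi) : IsConnBundle S := by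
  intro a ha c hc b hab hbc
  rw [hS] at *
  have h1 : a.val ≤ b.val := hab
  have h2 : b.val ≤ c.val := hbc
  omega

theorem prop1_bounded (n m : ℕ) (v : Fin n → Fin m → ℝ)
    (hneg : ∀ i j, v i j ≤ 0)
    (hnorm : ∀ i, bundleVal (v i) Finset.univ = -1) (hn : 0 < n) (L : ℝ)
    (hL : 2 / (n : ℝ) ≤ L) (hL2 : 1 / 2 ≤ L) (hown : ∀ j, ∃ i, - v i j ≤ L) :
    ∃ A : Fin n → Finset (Fin m), ConnAlloc n m A ∧ Prop1Chores n m v A ∧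
      -L ≤ egalW n m v A := by
  classical
  have hnR : (0 : ℝ) < n := by exact_mod_cast hn
  have : Nonempty (Fin n) := ⟨⟨0, hn⟩⟩
  have hTm : ∀ k x, m ≤ x → sufCost (v k) x = 0 := by
    intro k x hx
    unfold sufCost
    refine Finset.sum_eq_zero fun y _ => ?_
    have := y.isLt
    rw [if_neg (by omega)]
  have hT0 : ∀ k, sufCost (v k) 0 = 1 := by
    intro k
    have := bundleVal_interval (v k) Finset.univ 0 m (by omega) (by simp)
    rw [hTm k m le_rfl, hnorm] at this
    linarith
  have hanti : ∀ k x y, x ≤ y → sufCost (v k) y ≤ sufCost (v k) x := by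
    intro k x y hxy
    unfold sufCost
    refine Finset.sum_le_sum fun z _ => ?_
    have := hneg k z
    split_ifs with h1 h2 <;> first | omega | linarith
  have hitem : ∀ k (j : Fin m), v k j = -(sufCost (v k) j - sufCost (v k) (j + 1)) := by
    intro k j
    rw [← bundleVal_interval (v k) {j} j (j + 1) (by omega)]
    · simp [bundleVal]
    · intro x; simp [Fin.ext_iff]; omega
  have hmain := (main_alloc (ι := Fin n) (L := L) (θ := 1 / (n : ℝ)) (T := fun k => sufCost (v k))
    (m := m) (by positivity) (by rw [← mul_div_assoc]; simpa using hL) hL2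
    (fun k => (hT0 k).le) hTm hanti n).1 Finset.univ 0 (by simp) Finset.univ_nonempty
    (by
      intro k _
      left
      simp only [hT0]
      rw [mul_one_div_cancel hnR.ne'])
    (by
      intro j _ hj
      obtain ⟨i, hi⟩ := hown ⟨j, hj⟩
      refine ⟨i, Finset.mem_univ _, ?_⟩
      rw [hitem] at hi
      simpa using hi)
  obtain ⟨f, -, hf⟩ := hmain
  have key : ∀ k : Fin n, ∃ lo hi : ℕ,
      (∀ x : Fin m, f x = k ↔ (lo ≤ x.val ∧ x.val < hi)) ∧ hi ≤ m ∧
      AccI L (1 / (n : ℝ)) (sufCost (v k)) lo hi := by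
    intro k
    obtain ⟨lo, hi, h1, h2⟩ := hf k (Finset.mem_univ _)
    by_cases hlh : lo < hi
    · refine ⟨lo, hi, ?_, ?_, h2⟩
      · intro x
        rw [← h1]
        simp
      · have := (h1 (hi - 1)).2 (by omega)
        have := this.1.2
        omega
    · refine ⟨0, 0, ?_, by omega, fun h => by omega⟩
      intro x
      have := h1 x
      simp only [Set.mem_ofPred_eq, zero_le, true_and, x.isLt] at this
      beta_reduce
      rw [this]
      omega
  refine ⟨fun k => Finset.univ.filter fun x : Fin m => f x = k, ⟨?_, ?_, ?_⟩, ?_, ?_⟩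
  · intro k
    obtain ⟨lo, hi, h1, -, -⟩ := key k
    exact isConn_interval _ lo hi (by simpa using h1)
  · intro i j hij
    rw [Finset.disjoint_left]
    intro x hx hx'
    simp only [Finset.mem_filter, Finset.mem_univ, true_and] at hx hx'
    exact hij (hx.symm.trans hx')
  · intro e; exact ⟨f e, by simp⟩
  · intro k
    obtain ⟨lo, hi, h1, hm, h2⟩ := key k
    by_cases hlh : lo < hi
    · right
      obtain ⟨-, h | h⟩ := h2 hlh
      · have hS : ∀ x : Fin m, x ∈ (Finset.univ.filter fun x : Fin m => f x = k) \
            {⟨hi - 1, by omega⟩} ↔ lo ≤ x.val ∧ x.val < hi - 1 := by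
          intro x
          simp only [Finset.mem_sdiff, Finset.mem_filter, Finset.mem_univ, true_and,
            Finset.mem_singleton, h1, Fin.ext_iff]
          omega
        refine ⟨⟨hi - 1, by omega⟩, ?_, isConn_interval _ _ _ hS, ?_⟩
        · simp only [Finset.mem_filter, Finset.mem_univ, true_and, h1]; omega
        · rw [bundleVal_interval (v k) _ lo (hi - 1) (by omega) hS]; linarith
      · have hS : ∀ x : Fin m, x ∈ (Finset.univ.filter fun x : Fin m => f x = k) \
            {⟨lo, by omega⟩} ↔ lo + 1 ≤ x.val ∧ x.val < hi := by
          intro x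
          simp only [Finset.mem_sdiff, Finset.mem_filter, Finset.mem_univ, true_and,
            Finset.mem_singleton, h1, Fin.ext_iff]
          omega
        refine ⟨⟨lo, by omega⟩, ?_, isConn_interval _ _ _ hS, ?_⟩
        · simp only [Finset.mem_filter, Finset.mem_univ, true_and, h1]; omega
        · rw [bundleVal_interval (v k) _ (lo + 1) hi (by omega) hS]; linarith
    · left
      rw [Finset.filter_eq_empty_iff]
      intro x _
      rw [h1]; omega
  · unfold egalW
    refine le_ciInf fun k => ?_
    obtain ⟨lo, hi, h1, hm, h2⟩ := key k
    by_cases hlh : lo < hi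
    · rw [bundleVal_interval (v k) _ lo hi hlh.le (by simpa using h1)]
      linarith [(h2 hlh).1]
    · have : (Finset.univ.filter fun x : Fin m => f x = k) = ∅ := by
        rw [Finset.filter_eq_empty_iff]
        intro x _
        rw [h1]; omega
      beta_reduce
      rw [this]
      simp only [bundleVal, Finset.sum_empty]
      linarith

theorem prop1_factor (n m : ℕ) (v : Fin n → Fin m → ℝ)
    (hneg : ∀ i j, v i j ≤ 0)
    (hnorm : ∀ i, bundleVal (v i) Finset.univ = -1) (hn : 0 < n) (F : ℝ)
    (hF2 : 2 ≤ F) (hF : (n : ℝ) / 2 ≤ F) :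
    ∃ A : Fin n → Finset (Fin m), ConnAlloc n m A ∧ Prop1Chores n m v A ∧
      F * optE n m v ≤ egalW n m v A := by
  classical
  have hnR : (0 : ℝ) < n := by exact_mod_cast hn
  have : Nonempty (Fin n) := ⟨⟨0, hn⟩⟩
  have hfin : { x : ℝ | ∃ A, ConnAlloc n m A ∧ x = egalW n m v A }.Finite := by
    refine (Set.finite_range (fun A : Fin n → Finset (Fin m) => egalW n m v A)).subset ?_
    rintro x ⟨A, -, rfl⟩
    exact ⟨A, rfl⟩
  have hne : { x : ℝ | ∃ A, ConnAlloc n m A ∧ x = egalW n m v A }.Nonempty := by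
    refine ⟨_, fun i => if i = ⟨0, hn⟩ then Finset.univ else ∅, ⟨?_, ?_, ?_⟩, rfl⟩
    · intro i
      by_cases h : i = ⟨0, hn⟩ <;> simp [h, IsConnBundle]
    · intro i j hij
      by_cases h : i = ⟨0, hn⟩
      · have : j ≠ ⟨0, hn⟩ := fun h' => hij (h.trans h'.symm)
        simp [this]
      · simp [h]
    · intro e; exact ⟨⟨0, hn⟩, by simp⟩
  obtain ⟨O, hO, hOe⟩ := hne.csSup_mem hfin
  change optE n m v = egalW n m v O at hOe
  have hle : ∀ i, optE n m v ≤ bundleVal (v i) (O i) := by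
    intro i
    rw [hOe]
    exact ciInf_le (Set.finite_range _).bddBelow i
  have hopt0 : optE n m v ≤ 0 :=
    (hle ⟨0, hn⟩).trans (Finset.sum_nonpos fun e _ => hneg _ e)
  by_cases hw : -(1 / (n : ℝ)) ≤ optE n m v
  · refine ⟨O, hO, ?_, ?_⟩
    · intro i
      rcases Finset.eq_empty_or_nonempty (O i) with h | h
      · left; exact h
      · right
        refine ⟨(O i).max' h, Finset.max'_mem _ h, ?_, ?_⟩
        · intro a ha c hc b hab hbc
          simp only [Finset.mem_sdiff, Finset.mem_singleton] at *
          refine ⟨hO.1 i a ha.1 c hc.1 b hab hbc, ?_⟩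
          rintro hb
          exact hc.2 (le_antisymm (Finset.le_max' _ _ hc.1) (hb ▸ hbc))
        · refine (hw.trans (hle i)).trans ?_
          unfold bundleVal
          have := Finset.sum_sdiff (f := v i) (Finset.singleton_subset_iff.2 (Finset.max'_mem _ h))
          rw [Finset.sum_singleton] at this
          linarith [hneg i ((O i).max' h)]
    · rw [← hOe]; nlinarith
  · push Not at hw
    have hw' : 1 / (n : ℝ) < - optE n m v := by linarith
    have hpos : 0 < 1 / (n : ℝ) := by positivity
    obtain ⟨A, h1, h2, h3⟩ := prop1_bounded n m v hneg hnorm hn (F * (- optE n m v))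
      (by
        have : 2 / (n : ℝ) = 2 * (1 / n) := by ring
        rw [this]; nlinarith)
      (by
        have h : (1 : ℝ) / 2 = n / 2 * (1 / n) := by field_simp
        rw [h]
        have : 0 ≤ (n : ℝ) / 2 := by positivity
        exact mul_le_mul hF hw'.le hpos.le (by linarith))
      (by
        intro j
        obtain ⟨i, hi⟩ := hO.2.2 j
        refine ⟨i, ?_⟩
        have h4 := hle i
        unfold bundleVal at h4
        have := Finset.sum_sdiff (f := v i) (Finset.singleton_subset_iff.2 hi)
        rw [Finset.sum_singleton] at this
        have h5 : ∑ x ∈ O i \ {j}, v i x ≤ 0 := Finset.sum_nonpos fun e _ => hneg _ e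
        nlinarith)
    exact ⟨A, h1, h2, by linarith⟩

/-- For every fair-chores instance: if `n = 3` there exists a connected
PROP1 allocation with `EW(A) ≥ 2 · OPT_E`, and if `n ≥ 4` there exists a connected PROP1
allocation with `EW(A) ≥ (n/2) · OPT_E` (note `OPT_E ≤ 0`). -/
theorem chores_egalitarian_prop1_upper_bound (n m : ℕ)
    (v : Fin n → Fin m → ℝ)
    (hneg : ∀ i j, v i j ≤ 0)
    (hnorm : ∀ i, bundleVal (v i) Finset.univ = -1) :
    (n = 3 → ∃ A : Fin n → Finset (Fin m), ConnAlloc n m A ∧ Prop1Chores n m v A ∧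
      (2 : ℝ) * optE n m v ≤ egalW n m v A) ∧
    (4 ≤ n → ∃ A : Fin n → Finset (Fin m), ConnAlloc n m A ∧ Prop1Chores n m v A ∧
      ((n : ℝ) / 2) * optE n m v ≤ egalW n m v A) := by
  constructor
  · intro hn
    refine prop1_factor n m v hneg hnorm (by omega) 2 le_rfl ?_
    subst hn; norm_num
  · intro hn
    have : (4 : ℝ) ≤ n := by exact_mod_cast hn
    exact prop1_factor n m v hneg hnorm (by omega) _ (by linarith) le_rfl
end
end
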